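/- Let d be an integer, and for τ ∈ (d/2, d) define Δ_{τ,d} = {0} ∪ {τ − d/2} ∪ {k − d + τ : k ∈ ℤ, k > d − τ} ∪ {k − τ : k ∈ ℤ, τ < k ≤ d} ⊂ ℝ. Let C_d = {τ ∈ (d/2, d) : 2τ ∈ ℤ} if d is even and C_d = {τ ∈ (d/2, d) : 4τ ∈ ℤ} if d is odd. Suppose τ₁ ≤ τ₂ both lie in (d/2, d) and [τ₁, τ₂] ∩ C_d = ∅. Then the map φ : Δ_{τ₁,d} → Δ_{τ₂,d} given by φ(0) = 0, φ(τ₁ − d/2) = τ₂ − d/2, φ(k − d + τ₁) = k − d + τ₂ for each integer k > d − τ₁, and φ(k − τ₁) = k − τ₂ for each integer k with τ₁ < k ≤ d, is well defined and is an order-preserving bijection from Δ_{τ₁,d} onto Δ_{τ₂,d}. -/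

import Mathlib

/-- The index set `Δ_{τ,d}` of Yang–Mills–Higgs critical values for rank-2 pairs of
degree `d` and parameter `τ ∈ (d/2, d)`:
`Δ_{τ,d} = {0} ∪ {τ − d/2} ∪ {k − d + τ : k ∈ ℤ, k > d − τ} ∪ {k − τ : k ∈ ℤ, τ < k ≤ d}`. -/
def DeltaSet (d : ℤ) (τ : ℝ) : Set ℝ :=
  {0} ∪ {τ - (d : ℝ) / 2} ∪
    {x : ℝ | ∃ k : ℤ, (d : ℝ) - τ < (k : ℝ) ∧ x = (k : ℝ) - d + τ} ∪
    {x : ℝ | ∃ k : ℤ, τ < (k : ℝ) ∧ (k : ℝ) ≤ (d : ℝ) ∧ x = (k : ℝ) - τ}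

/-- The set `C_d` of critical parameter values: `C_d = {τ ∈ (d/2, d) : 2τ ∈ ℤ}` if `d`
is even, and `C_d = {τ ∈ (d/2, d) : 4τ ∈ ℤ}` if `d` is odd. -/
def CritSet (d : ℤ) : Set ℝ :=
  if Even d then
    {τ : ℝ | (d : ℝ) / 2 < τ ∧ τ < (d : ℝ) ∧ ∃ k : ℤ, 2 * τ = (k : ℝ)}
  else
    {τ : ℝ | (d : ℝ) / 2 < τ ∧ τ < (d : ℝ) ∧ ∃ k : ℤ, 4 * τ = (k : ℝ)}

/-- No half-integer lies in an interval of parameters avoiding the critical set. -/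
theorem lt_or_lt_of_inter_critSet_eq_empty {d : ℤ} {τ₁ τ₂ : ℝ}
    (h1 : (d : ℝ) / 2 < τ₁) (h2 : τ₂ < (d : ℝ)) (hC : Set.Icc τ₁ τ₂ ∩ CritSet d = ∅) (m : ℤ) :
    (m : ℝ) < 2 * τ₁ ∨ 2 * τ₂ < (m : ℝ) := by
  by_contra! h
  have hm : (m : ℝ) / 2 ∈ Set.Icc τ₁ τ₂ ∩ CritSet d := by
    refine ⟨⟨by linarith, by linarith⟩, ?_⟩
    unfold CritSet
    split_ifs
    · exact ⟨by linarith, by linarith, m, by ring⟩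
    · exact ⟨by linarith, by linarith, 2 * m, by push_cast; ring⟩
  rw [hC] at hm
  exact hm

/-- No number of the form `(m + d / 2) / 2` lies in an interval of parameters avoiding the
critical set. -/
theorem two_mul_add_lt_or_lt_of_inter_critSet_eq_empty {d : ℤ} {τ₁ τ₂ : ℝ}
    (h1 : (d : ℝ) / 2 < τ₁) (h2 : τ₂ < (d : ℝ)) (hC : Set.Icc τ₁ τ₂ ∩ CritSet d = ∅) (m : ℤ) :
    2 * (m : ℝ) + d < 4 * τ₁ ∨ 4 * τ₂ < 2 * (m : ℝ) + d := by
  by_contra! h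
  have hm : (2 * (m : ℝ) + d) / 4 ∈ Set.Icc τ₁ τ₂ ∩ CritSet d := by
    refine ⟨⟨by linarith, by linarith⟩, ?_⟩
    unfold CritSet
    split_ifs with hd
    · obtain ⟨e, rfl⟩ := hd
      exact ⟨by linarith, by linarith, m + e, by push_cast; ring⟩
    · exact ⟨by linarith, by linarith, 2 * m + d, by push_cast; ring⟩
  rw [hC] at hm
  exact hm

open Classical in
/-- The flip map: it fixes `0`, translates the family `k - τ₁` down by `τ₂ - τ₁`, and
translates everything else up by `τ₂ - τ₁`. -/
noncomputable def flipMap (d : ℤ) (τ₁ τ₂ x : ℝ) : ℝ :=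
  if x = 0 then 0
  else if ∃ k : ℤ, τ₁ < (k : ℝ) ∧ (k : ℝ) ≤ (d : ℝ) ∧ x = (k : ℝ) - τ₁ then x - (τ₂ - τ₁)
  else x + (τ₂ - τ₁)

/-- Suppose `τ₁ ≤ τ₂` both lie in `(d/2, d)` and `[τ₁, τ₂] ∩ C_d = ∅`.
Then the map `φ : Δ_{τ₁,d} → Δ_{τ₂,d}` given by `φ(0) = 0`, `φ(τ₁ − d/2) = τ₂ − d/2`,
`φ(k − d + τ₁) = k − d + τ₂` for each integer `k > d − τ₁`, and `φ(k − τ₁) = k − τ₂`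
for each integer `k` with `τ₁ < k ≤ d`, is well defined and is an order-preserving
bijection from `Δ_{τ₁,d}` onto `Δ_{τ₂,d}`. -/
theorem delta_flip_bijection (d : ℤ) (τ₁ τ₂ : ℝ)
    (h1 : (d : ℝ) / 2 < τ₁) (h12 : τ₁ ≤ τ₂) (h2 : τ₂ < (d : ℝ))
    (hC : Set.Icc τ₁ τ₂ ∩ CritSet d = ∅) :
    ∃ φ : ℝ → ℝ,
      φ 0 = 0 ∧
      φ (τ₁ - (d : ℝ) / 2) = τ₂ - (d : ℝ) / 2 ∧
      (∀ k : ℤ, (d : ℝ) - τ₁ < (k : ℝ) → φ ((k : ℝ) - d + τ₁) = (k : ℝ) - d + τ₂) ∧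
      (∀ k : ℤ, τ₁ < (k : ℝ) → (k : ℝ) ≤ (d : ℝ) → φ ((k : ℝ) - τ₁) = (k : ℝ) - τ₂) ∧
      Set.BijOn φ (DeltaSet d τ₁) (DeltaSet d τ₂) ∧
      (∀ x ∈ DeltaSet d τ₁, ∀ y ∈ DeltaSet d τ₁, x < y → φ x < φ y) := by
  have half := lt_or_lt_of_inter_critSet_eq_empty h1 h2 hC
  have quarter := two_mul_add_lt_or_lt_of_inter_critSet_eq_empty h1 h2 hC
  have hzero : flipMap d τ₁ τ₂ 0 = 0 := if_pos rfl
  have hmid : flipMap d τ₁ τ₂ (τ₁ - (d : ℝ) / 2) = τ₂ - (d : ℝ) / 2 := by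
    rw [flipMap, if_neg (by linarith), if_neg]
    · ring
    · rintro ⟨k, -, -, hk⟩
      rcases quarter k with h | h <;> linarith
  have hplus : ∀ k : ℤ, (d : ℝ) - τ₁ < (k : ℝ) →
      flipMap d τ₁ τ₂ ((k : ℝ) - d + τ₁) = (k : ℝ) - d + τ₂ := by
    intro k hk
    rw [flipMap, if_neg (by linarith), if_neg]
    · ring
    · rintro ⟨j, -, -, hj⟩
      have h := half (j + d - k)
      push_cast at h
      rcases h with h | h <;> linarith
  have hminus : ∀ k : ℤ, τ₁ < (k : ℝ) → (k : ℝ) ≤ (d : ℝ) →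
      flipMap d τ₁ τ₂ ((k : ℝ) - τ₁) = (k : ℝ) - τ₂ := by
    intro k hk hkd
    rw [flipMap, if_neg (by linarith), if_pos ⟨k, hk, hkd, rfl⟩]
    ring
  have above : ∀ k : ℤ, τ₁ < (k : ℝ) → τ₂ < (k : ℝ) := by
    intro k hk
    have h := half (2 * k)
    push_cast at h
    rcases h with h | h <;> linarith
  have below : ∀ k : ℤ, (d : ℝ) - τ₂ < (k : ℝ) → (d : ℝ) - τ₁ < (k : ℝ) := by
    intro k hk
    have h := half (2 * (d - k))
    push_cast at h
    rcases h with h | h <;> linarith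
  have hmono : ∀ x ∈ DeltaSet d τ₁, ∀ y ∈ DeltaSet d τ₁, x < y →
      flipMap d τ₁ τ₂ x < flipMap d τ₁ τ₂ y := by
    rintro x (((rfl | rfl) | ⟨k, hk, rfl⟩) | ⟨k, hk, hkd, rfl⟩) y
      (((rfl | rfl) | ⟨j, hj, rfl⟩) | ⟨j, hj, hjd, rfl⟩) hxy
    · exact absurd hxy (lt_irrefl _)
    · rw [hzero, hmid]; linarith
    · rw [hzero, hplus j hj]; linarith
    · rw [hzero, hminus j hj hjd]; linarith [above j hj]
    · linarith
    · exact absurd hxy (lt_irrefl _)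
    · rw [hmid, hplus j hj]; linarith
    · rw [hmid, hminus j hj hjd]
      rcases quarter j with h | h <;> linarith
    · linarith
    · rw [hplus k hk, hmid]; linarith
    · rw [hplus k hk, hplus j hj]; linarith
    · rw [hplus k hk, hminus j hj hjd]
      have h := half (j + d - k)
      push_cast at h
      rcases h with h | h <;> linarith
    · linarith
    · rw [hminus k hk hkd, hmid]; linarith
    · rw [hminus k hk hkd, hplus j hj]; linarith
    · rw [hminus k hk hkd, hminus j hj hjd]; linarith
  refine ⟨flipMap d τ₁ τ₂, hzero, hmid, hplus, hminus, ⟨?_, ?_, ?_⟩, hmono⟩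
  · rintro x (((rfl | rfl) | ⟨k, hk, rfl⟩) | ⟨k, hk, hkd, rfl⟩)
    · rw [hzero]; exact .inl (.inl (.inl rfl))
    · rw [hmid]; exact .inl (.inl (.inr rfl))
    · rw [hplus k hk]; exact .inl (.inr ⟨k, by linarith, rfl⟩)
    · rw [hminus k hk hkd]; exact .inr ⟨k, above k hk, hkd, rfl⟩
  · exact StrictMonoOn.injOn fun x hx y hy => hmono x hx y hy
  · rintro y (((rfl | rfl) | ⟨k, hk, rfl⟩) | ⟨k, hk, hkd, rfl⟩)
    · exact ⟨0, .inl (.inl (.inl rfl)), hzero⟩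
    · exact ⟨_, .inl (.inl (.inr rfl)), hmid⟩
    · exact ⟨_, .inl (.inr ⟨k, below k hk, rfl⟩), hplus k (below k hk)⟩
    · exact ⟨_, .inr ⟨k, h12.trans_lt hk, hkd, rfl⟩, hminus k (h12.trans_lt hk) hkd⟩
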